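/- arXiv:1401.1388 — 2 statements merged into one kernel-verified Lean document; each statement's English description precedes it below -/
import Mathlib

section
/- For any finite family {Aᵢ} of 2×2 complex matrices, the Choi matrix of the dual family equals the entrywise complex conjugate of the swap conjugation of the Choi matrix of the original family: ∑ᵢ (1⊗Aᵢ†)|Φ⁺⟩⟨Φ⁺|(1⊗Aᵢ) = ( V† (∑ᵢ (1⊗Aᵢ)|Φ⁺⟩⟨Φ⁺|(1⊗Aᵢ)†) V )*, i.e. ρ_{Φ⁺,Λ̂} = (V† ρ_{Φ⁺,Λ} V)*. -/
open Matrix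
open scoped Kronecker

noncomputable section

/-- 2×2 complex matrices (single-qubit operators). -/
abbrev QMat := Matrix (Fin 2) (Fin 2) ℂ

/-- 4×4 complex matrices indexed by `Fin 2 × Fin 2` (two-qubit operators). -/
abbrev TMat := Matrix (Fin 2 × Fin 2) (Fin 2 × Fin 2) ℂ

/-- Vectors in ℂ²⊗ℂ², indexed by `Fin 2 × Fin 2`. -/
abbrev TVec := (Fin 2 × Fin 2) → ℂ

/-- Outer product |ψ⟩⟨φ|. -/
def outer (ψ φ : TVec) : TMat := Matrix.vecMulVec ψ (star φ)

/-- The maximally entangled vector |Φ⁺⟩ = (|00⟩+|11⟩)/√2. -/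
def phiPlus : TVec := fun p => if p.1 = p.2 then ((Real.sqrt 2 : ℂ))⁻¹ else 0

/-- Action of id ⊗ Λ on two-qubit matrices, for a channel Λ with Kraus family `A`. -/
def channelOut {ι : Type*} [Fintype ι] (A : ι → QMat) (M : TMat) : TMat :=
  ∑ i, ((1 : QMat) ⊗ₖ A i) * M * ((1 : QMat) ⊗ₖ A i)ᴴ

/-- The Choi matrix ρ_{Φ⁺,Λ} = (id⊗Λ)(|Φ⁺⟩⟨Φ⁺|). -/
def choi {ι : Type*} [Fintype ι] (A : ι → QMat) : TMat :=
  channelOut A (outer phiPlus phiPlus)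

/-- The Choi matrix of the dual channel: ρ_{Φ⁺,Λ̂} = ∑ᵢ (1⊗Aᵢᴴ)|Φ⁺⟩⟨Φ⁺|(1⊗Aᵢ). -/
def choiDual {ι : Type*} [Fintype ι] (A : ι → QMat) : TMat :=
  channelOut (fun i => (A i)ᴴ) (outer phiPlus phiPlus)

/-- Kraus (trace-preserving) condition ∑ᵢ Aᵢᴴ Aᵢ = 1. -/
def IsKraus {ι : Type*} [Fintype ι] (A : ι → QMat) : Prop := ∑ i, (A i)ᴴ * A i = 1

/-- Partial trace over the second factor. -/
def ptraceB (M : TMat) : QMat := Matrix.of fun i j => ∑ k, M (i, k) (j, k)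

/-- Unit vector: ⟨ψ|ψ⟩ = 1. -/
def IsUnitVec (ψ : TVec) : Prop := star ψ ⬝ᵥ ψ = 1

/-- Maximally entangled vector: the partial trace of |ψ⟩⟨ψ| over the second
factor is (1/2)·1. -/
def MaxEnt (ψ : TVec) : Prop := ptraceB (outer ψ ψ) = (1/2 : ℂ) • 1

/-- Partial transpose on the first factor: M^Γ((i,k),(j,l)) = M((j,k),(i,l)). -/
def ptransp (M : TMat) : TMat := Matrix.of fun p q => M (q.1, p.2) (p.1, q.2)

open Classical in
/-- Largest eigenvalue of a Hermitian matrix (junk value 0 otherwise). -/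
def lamMax {n : Type*} [Fintype n] [DecidableEq n] (M : Matrix n n ℂ) : ℝ :=
  if h : M.IsHermitian then ⨆ i, h.eigenvalues i else 0

open Classical in
/-- Smallest eigenvalue of a Hermitian matrix (junk value 0 otherwise). -/
def lamMin {n : Type*} [Fintype n] [DecidableEq n] (M : Matrix n n ℂ) : ℝ :=
  if h : M.IsHermitian then ⨅ i, h.eigenvalues i else 0

/-- Negativity N(ρ) = max{0, −2 λ_min(ρ^Γ)}. -/
def negativity (M : TMat) : ℝ := max 0 (-2 * lamMin (ptransp M))

/-- The swap operator V on ℂ²⊗ℂ²: V(eᵢ⊗eⱼ) = eⱼ⊗eᵢ. -/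
def swapM : TMat := Matrix.of fun p q => if p.1 = q.2 ∧ p.2 = q.1 then 1 else 0

/-- The vector √λ|00⟩ + √(1−λ)|11⟩. -/
def xvec (l : ℝ) : TVec := fun p =>
  if p = (0, 0) then (Real.sqrt l : ℂ) else if p = (1, 1) then (Real.sqrt (1 - l) : ℂ) else 0

/-- Kraus operators of the amplitude damping channel with parameter p. -/
def adKraus (p : ℝ) : Fin 2 → QMat :=
  ![!![1, 0; 0, (Real.sqrt (1 - p) : ℂ)], !![0, (Real.sqrt p : ℂ); 0, 0]]

end

theorem one_kronecker_mulVec_phiPlus (B : QMat) :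
    ((1 : QMat) ⊗ₖ B) *ᵥ phiPlus = fun p => B p.2 p.1 * ((Real.sqrt 2 : ℂ))⁻¹ := by
  ext ⟨a, b⟩
  simp [Matrix.mulVec, dotProduct, phiPlus, Fintype.sum_prod_type, Matrix.one_apply]

theorem mul_outer_mul_conjTranspose (M : TMat) (ψ φ : TVec) :
    M * outer ψ φ * Mᴴ = outer (M *ᵥ ψ) (M *ᵥ φ) := by
  simp only [outer, Matrix.mul_vecMulVec, Matrix.vecMulVec_mul, Matrix.star_mulVec]

/-- The Choi matrix has entries `½ ∑ᵢ (Aᵢ)_{ba} conj((Aᵢ)_{dc})`, with the factor `½` kept as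
the square of the amplitude `1/√2`. -/
theorem choi_apply {ι : Type*} [Fintype ι] (A : ι → QMat) (p q : Fin 2 × Fin 2) :
    choi A p q = ∑ i, A i p.2 p.1 * ((Real.sqrt 2 : ℂ))⁻¹ *
      star (A i q.2 q.1 * ((Real.sqrt 2 : ℂ))⁻¹) := by
  simp only [choi, channelOut, mul_outer_mul_conjTranspose, one_kronecker_mulVec_phiPlus,
    Matrix.sum_apply]
  rfl

theorem swapM_conj_apply (M : TMat) (p q : Fin 2 × Fin 2) :
    (swapMᴴ * M * swapM) p q = M p.swap q.swap := by
  have h : swapM = (1 : TMat).submatrix id Prod.swap := by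
    ext ⟨a, b⟩ ⟨c, d⟩
    simp [swapM, Matrix.one_apply]
  simp [h, Matrix.mul_apply, Matrix.one_apply]

/-- ρ_{Φ⁺,Λ̂} = (V† ρ_{Φ⁺,Λ} V)* for any finite family of 2×2 matrices. -/
theorem stmt5 {ι : Type*} [Fintype ι] (A : ι → QMat) :
    choiDual A = ((swapM)ᴴ * choi A * swapM).map (starRingEnd ℂ) := by
  ext p q
  rw [Matrix.map_apply, swapM_conj_apply, show choiDual A = choi fun i => (A i)ᴴ from rfl]
  simp only [choi_apply, map_sum]
  refine Finset.sum_congr rfl fun i _ => ?_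
  simp [Matrix.conjTranspose_apply]
end

section
/- Let Λ be a qubit channel such that λ_max(ρ_{Φ⁺,Λ}) ≥ 1/2. Then (1/2)·(1 + N(ρ_{Φ⁺,Λ})) = λ_max(ρ_{Φ⁺,Λ}), where N(ρ) = max{0, −2·λ_min(ρ^Γ)} is the negativity. -/
open Matrix
open scoped Kronecker

theorem lamMax_eq_sSup_spectrum {n : Type*} [Fintype n] [DecidableEq n] {M : Matrix n n ℂ}
    (hM : M.IsHermitian) : lamMax M = sSup (spectrum ℝ M) := by
  rw [lamMax, dif_pos hM, hM.spectrum_real_eq_range_eigenvalues, sSup_range]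

theorem lamMin_eq_sInf_spectrum {n : Type*} [Fintype n] [DecidableEq n] {M : Matrix n n ℂ}
    (hM : M.IsHermitian) : lamMin M = sInf (spectrum ℝ M) := by
  rw [lamMin, dif_pos hM, hM.spectrum_real_eq_range_eigenvalues, sInf_range]

theorem spectrum_real_transpose {n : Type*} [Fintype n] [DecidableEq n] (M : Matrix n n ℂ) :
    spectrum ℝ Mᵀ = spectrum ℝ M := by
  ext r
  have : algebraMap ℝ (Matrix n n ℂ) r - Mᵀ = (algebraMap ℝ (Matrix n n ℂ) r - M)ᵀ := by
    simp [Matrix.algebraMap_eq_diagonal]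
  rw [spectrum.mem_iff, spectrum.mem_iff, this, Matrix.isUnit_transpose]

open scoped Pointwise in
/-- If `N` is unitarily similar to `r - Mᵀ`, then its least eigenvalue is `r - λ_max(M)`. -/
theorem lamMin_eq_sub_lamMax {n : Type*} [Fintype n] [DecidableEq n] [Nonempty n]
    {M N : Matrix n n ℂ} (hM : M.IsHermitian) (hN : N.IsHermitian) (r : ℝ)
    (u : (Matrix n n ℂ)ˣ)
    (h : N = u * (algebraMap ℝ (Matrix n n ℂ) r - Mᵀ) * (↑u⁻¹ : Matrix n n ℂ)) :
    lamMin N = r - lamMax M := by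
  rw [lamMin_eq_sInf_spectrum hN, lamMax_eq_sSup_spectrum hM, h, spectrum.units_conjugate,
    ← spectrum.singleton_sub_eq, spectrum_real_transpose]
  have hr := hM.spectrum_real_eq_range_eigenvalues
  rw [csInf_sub (Set.singleton_nonempty r) bddBelow_singleton
    (hr ▸ Set.range_nonempty _) (hr ▸ (Set.finite_range _).bddAbove), csInf_singleton]

/-- The local spin flip `1 ⊗ J` on the second qubit, with `J` the symplectic unit. -/
def spinFlip : TMatˣ where
  val := (1 : QMat) ⊗ₖ !![0, 1; -1, 0]
  inv := (1 : QMat) ⊗ₖ !![0, -1; 1, 0]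
  val_inv := by
    rw [← Matrix.mul_kronecker_mul]
    simp [← Matrix.one_fin_two]
  inv_val := by
    rw [← Matrix.mul_kronecker_mul]
    simp [← Matrix.one_fin_two]

/-- The reduction identity: if `tr_B M = r`, then `M^Γ` is the spin flip of `r - Mᵀ`. -/
theorem ptransp_eq_spinFlip_conj {M : TMat} {r : ℝ}
    (h : ptraceB M = algebraMap ℝ QMat r) :
    ptransp M = spinFlip * (algebraMap ℝ TMat r - Mᵀ) * (↑spinFlip⁻¹ : TMat) := by
  have key : ∀ i j, M (i, 0) (j, 0) + M (i, 1) (j, 1) = if i = j then (r : ℂ) else 0 := by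
    intro i j
    have := congrFun (congrFun h i) j
    simpa [ptraceB, Matrix.algebraMap_matrix_apply] using this
  have h00 := key 0 0
  have h01 := key 0 1
  have h10 := key 1 0
  have h11 := key 1 1
  simp only [Units.inv_mk, spinFlip]
  ext ⟨i, k⟩ ⟨j, l⟩
  fin_cases i <;> fin_cases k <;> fin_cases j <;> fin_cases l <;>
    simp [ptransp, Matrix.mul_apply, Fintype.sum_prod_type, Matrix.algebraMap_matrix_apply] at * <;>
    first | linear_combination h00 | linear_combination h01 | linear_combination h10 |
      linear_combination h11

theorem isHermitian_ptransp {M : TMat} (hM : M.IsHermitian) : (ptransp M).IsHermitian :=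
  Matrix.IsHermitian.ext fun _ _ => hM.apply _ _

theorem choi_apply_s10 {ι : Type*} [Fintype ι] (A : ι → QMat) (i k j l : Fin 2) :
    choi A (i, k) (j, l) = 1 / 2 * ∑ m, A m k i * star (A m l j) := by
  have h2 : ((Real.sqrt 2 : ℂ))⁻¹ * ((Real.sqrt 2 : ℂ))⁻¹ = 1 / 2 := by
    rw [← mul_inv, ← Complex.ofReal_mul, Real.mul_self_sqrt (by norm_num)]
    norm_num
  rw [choi, channelOut, Matrix.sum_apply, Finset.mul_sum]
  refine Finset.sum_congr rfl fun m _ => ?_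
  rw [← h2]
  fin_cases i <;> fin_cases j <;>
    simp [outer, phiPlus, Matrix.mul_apply, Matrix.vecMulVec_apply, Fintype.sum_prod_type,
      Matrix.one_apply] <;> ring

theorem isHermitian_choi {ι : Type*} [Fintype ι] (A : ι → QMat) : (choi A).IsHermitian := by
  refine Matrix.IsHermitian.ext fun p q => ?_
  rw [choi_apply_s10, choi_apply_s10]
  simp [mul_comm]

theorem ptraceB_choi {ι : Type*} [Fintype ι] {A : ι → QMat} (hA : IsKraus A) :
    ptraceB (choi A) = algebraMap ℝ QMat (1 / 2) := by
  ext i j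
  have h := congrFun (congrFun hA j) i
  rw [Matrix.sum_apply] at h
  simp only [Matrix.mul_apply, Matrix.conjTranspose_apply] at h
  rw [Finset.sum_comm] at h
  simp only [ptraceB, Matrix.of_apply, choi_apply_s10, ← Finset.mul_sum]
  simp only [mul_comm (A _ _ i), h, Matrix.algebraMap_matrix_apply, Matrix.one_apply, eq_comm]
  split_ifs <;> simp

/-- if λ_max(ρ_{Φ⁺,Λ}) ≥ 1/2 then
(1/2)(1 + N(ρ_{Φ⁺,Λ})) = λ_max(ρ_{Φ⁺,Λ}). -/
theorem stmt10 {ι : Type*} [Fintype ι] (A : ι → QMat) (hA : IsKraus A)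
    (h : 1/2 ≤ lamMax (choi A)) :
    (1/2 : ℝ) * (1 + negativity (choi A)) = lamMax (choi A) := by
  have hH := isHermitian_choi A
  have hmin : lamMin (ptransp (choi A)) = 1 / 2 - lamMax (choi A) :=
    lamMin_eq_sub_lamMax hH (isHermitian_ptransp hH) (1 / 2) spinFlip
      (ptransp_eq_spinFlip_conj (ptraceB_choi hA))
  rw [negativity, hmin, max_eq_right (by linarith)]
  ring
end
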